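/- arXiv:1304.3202 — 7 statements merged into one kernel-verified Lean document; each statement's English description precedes it below -/
import Mathlib

section
/- Let $\delta > 0$, $v_1 \in \mathbb{C}$, $p \in \mathbb{N}$, and let $u$ be holomorphic on the open disk $D(0, 2\delta)$; define $g(z) = z^p u(z)$. Then there exist $\epsilon_0 > 0$ and $M_0 > 0$ such that for every $\epsilon \in \mathbb{C}$ with $|\epsilon| < \epsilon_0$ and every $z \in \overline{D}(0,\delta)$ one has $1 - \epsilon v_1 z \neq 0$, $z/(1 - \epsilon v_1 z) \in D(0, 2\delta)$, and $\big| g(z) - g\big(z/(1 - \epsilon v_1 z)\big) \big| \le M_0\, |\epsilon|\, |z|^{p+1}$. -/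
open Metric Complex

/-- A function holomorphic on a disk is Lipschitz on every smaller concentric closed disk. -/
theorem exists_norm_sub_le_of_differentiableOn_ball {f : ℂ → ℂ} {c : ℂ} {r R : ℝ} (hr : r < R)
    (hf : DifferentiableOn ℂ f (ball c R)) :
    ∃ L ≥ (0 : ℝ), ∀ x ∈ closedBall c r, ∀ y ∈ closedBall c r, ‖f y - f x‖ ≤ L * ‖y - x‖ := by
  have hsub : closedBall c r ⊆ ball c R := closedBall_subset_ball hr
  obtain ⟨C, hC⟩ := (isCompact_closedBall c r).exists_bound_of_continuousOn
    ((hf.deriv isOpen_ball).continuousOn.mono hsub)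
  refine ⟨max C 0, le_max_right _ _, fun x hx y hy => ?_⟩
  exact (convex_closedBall c r).norm_image_sub_le_of_norm_deriv_le
    (fun w hw => hf.differentiableAt (isOpen_ball.mem_nhds (hsub hw)))
    (fun w hw => (hC w hw).trans (le_max_left _ _)) hx hy

/-- If `‖t‖ ≤ 1 / 4`, then `1 / (1 - t)` is well defined and within `2 * ‖t‖` of `1`. -/
theorem norm_inv_one_sub_sub_one_le {t : ℂ} (ht : ‖t‖ ≤ 1 / 4) :
    1 - t ≠ 0 ∧ ‖1 - (1 - t)⁻¹‖ ≤ 2 * ‖t‖ := by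
  have hlow : (1 / 2 : ℝ) ≤ ‖1 - t‖ := by
    have := norm_sub_norm_le (1 : ℂ) t
    rw [norm_one] at this
    linarith
  have hne : 1 - t ≠ 0 := norm_pos_iff.mp (by linarith)
  refine ⟨hne, ?_⟩
  have heq : 1 - (1 - t)⁻¹ = -t / (1 - t) := by
    field_simp
    ring
  rw [heq, norm_div, norm_neg, div_le_iff₀ (by linarith)]
  nlinarith [norm_nonneg t]

/-- Taylor-expansion estimate: if `g(z) = z^p u(z)` with `u` holomorphic on `D(0,2δ)`, then
`|g(z) - g(z/(1-εv₁z))| ≤ M₀ |ε| |z|^(p+1)` uniformly on the closed disk of radius `δ`. -/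
theorem stmt_1 (δ : ℝ) (hδ : 0 < δ) (v₁ : ℂ) (p : ℕ) (u : ℂ → ℂ)
    (hu : DifferentiableOn ℂ u (ball (0 : ℂ) (2 * δ)))
    (g : ℂ → ℂ) (hg : ∀ z, g z = z ^ p * u z) :
    ∃ ε₀ > (0 : ℝ), ∃ M₀ > (0 : ℝ), ∀ ε : ℂ, ‖ε‖ < ε₀ →
      ∀ z ∈ closedBall (0 : ℂ) δ,
        1 - ε * v₁ * z ≠ 0 ∧
        z / (1 - ε * v₁ * z) ∈ ball (0 : ℂ) (2 * δ) ∧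
        ‖g z - g (z / (1 - ε * v₁ * z))‖ ≤ M₀ * ‖ε‖ * ‖z‖ ^ (p + 1) := by
  have hr : 3 / 2 * δ < 2 * δ := by linarith
  obtain ⟨L, hL0, hL⟩ := exists_norm_sub_le_of_differentiableOn_ball hr hu
  obtain ⟨K, hK0, hK⟩ := exists_norm_sub_le_of_differentiableOn_ball (f := fun w : ℂ => w ^ p)
    (c := 0) (r := 3 / 2) (R := 2) (by norm_num) (differentiable_pow p).differentiableOn
  obtain ⟨B, hB⟩ := (isCompact_closedBall (0 : ℂ) (3 / 2 * δ)).exists_bound_of_continuousOn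
    (hu.continuousOn.mono (closedBall_subset_ball hr))
  have hB0 : 0 ≤ B := (norm_nonneg _).trans (hB 0 (mem_closedBall_self (by positivity)))
  refine ⟨1 / (4 * δ * (‖v₁‖ + 1)), by positivity, (L * δ + K * B) * (2 * ‖v₁‖) + 1,
    by positivity, fun ε hε z hz => ?_⟩
  rw [mem_closedBall_zero_iff] at hz
  have ht : ‖ε * v₁ * z‖ ≤ 1 / 4 := by
    rw [lt_div_iff₀ (by positivity)] at hε
    calc ‖ε * v₁ * z‖ = ‖ε‖ * ‖v₁‖ * ‖z‖ := by rw [norm_mul, norm_mul]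
      _ ≤ ‖ε‖ * (‖v₁‖ + 1) * δ := by gcongr; linarith
      _ ≤ 1 / 4 := by linarith
  obtain ⟨hne, hc⟩ := norm_inv_one_sub_sub_one_le ht
  rw [div_eq_mul_inv]
  set c := (1 - ε * v₁ * z)⁻¹
  have hcn : ‖c‖ ≤ 3 / 2 := by
    have h := norm_sub_norm_le c 1
    rw [norm_one, norm_sub_rev] at h
    linarith
  have hzc : ‖z * c‖ ≤ 3 / 2 * δ := by
    rw [norm_mul, mul_comm]
    gcongr
  refine ⟨hne, mem_ball_zero_iff.mpr (hzc.trans_lt hr), ?_⟩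
  have hu_sub : ‖u z - u (z * c)‖ ≤ L * δ * ‖1 - c‖ := by
    calc ‖u z - u (z * c)‖ ≤ L * ‖z - z * c‖ :=
          hL _ (mem_closedBall_zero_iff.mpr hzc) _ (mem_closedBall_zero_iff.mpr (by linarith))
      _ = L * ‖z‖ * ‖1 - c‖ := by rw [← mul_one_sub, norm_mul, mul_assoc]
      _ ≤ L * δ * ‖1 - c‖ := by gcongr
  have hpow_sub : ‖1 - c ^ p‖ ≤ K * ‖1 - c‖ := by
    simpa using hK c (mem_closedBall_zero_iff.mpr hcn) 1
      (mem_closedBall_zero_iff.mpr (by norm_num))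
  have hsplit : g z - g (z * c) = z ^ p * ((u z - u (z * c)) + (1 - c ^ p) * u (z * c)) := by
    rw [hg, hg, mul_pow]
    ring
  calc ‖g z - g (z * c)‖
      ≤ ‖z‖ ^ p * (‖u z - u (z * c)‖ + ‖1 - c ^ p‖ * ‖u (z * c)‖) := by
        rw [hsplit, norm_mul, norm_pow, ← norm_mul]
        gcongr
        exact norm_add_le _ _
    _ ≤ ‖z‖ ^ p * (L * δ * ‖1 - c‖ + K * ‖1 - c‖ * B) := by
        gcongr
        exact hB _ (mem_closedBall_zero_iff.mpr hzc)
    _ = ‖z‖ ^ p * ((L * δ + K * B) * ‖1 - c‖) := by ring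
    _ ≤ ‖z‖ ^ p * ((L * δ + K * B) * (2 * ‖ε * v₁ * z‖)) := by gcongr
    _ = (L * δ + K * B) * (2 * ‖v₁‖) * ‖ε‖ * ‖z‖ ^ (p + 1) := by
        rw [norm_mul, norm_mul]
        ring
    _ ≤ ((L * δ + K * B) * (2 * ‖v₁‖) + 1) * ‖ε‖ * ‖z‖ ^ (p + 1) := by
        gcongr
        linarith
end

section
/- Let $\delta > 0$, let $v_1, v_2 \in \mathbb{C} \setminus \{0\}$, and let $m, M, m_0 > 0$. Let $g$ be holomorphic on the open disk $D(0, 2\delta)$ and satisfy $m \le |g(z)| \le M$ and $|g(z) - v_1/v_2| \ge m_0$ for all $z \in D(0, 2\delta)$; define $f(z) = z\, g(z)$. Then there exist $\delta_0 \in (0, \delta]$, $\epsilon_0 > 0$ and $c_0 > 0$ such that for every $\epsilon \in \mathbb{C}$ with $0 < |\epsilon| < \epsilon_0$ and every $z$ with $|z| = \delta_0$: $1 - \epsilon v_1 z \neq 0$, the point $z' := z/(1 - \epsilon v_1 z)$ lies in $D(0,2\delta)$, $1 + \epsilon v_2 f(z') \neq 0$, and $\Big| f(z) - \dfrac{f(z')}{1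 + \epsilon v_2 f(z')} \Big| \ge c_0\, |\epsilon|$. -/
open Metric Complex

/-- A function holomorphic near a point is Lipschitz on a small ball around it. -/
theorem DifferentiableOn.exists_ball_norm_sub_le {g : ℂ → ℂ} {s : Set ℂ} {x : ℂ}
    (hg : DifferentiableOn ℂ g s) (hs : s ∈ nhds x) :
    ∃ r > (0 : ℝ), ∃ K : ℝ, 0 ≤ K ∧
      ∀ a ∈ ball x r, ∀ b ∈ ball x r, ‖g a - g b‖ ≤ K * ‖a - b‖ := by
  have hc : ContDiffAt ℂ 1 g x := (hg.analyticAt hs).contDiffAt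
  obtain ⟨K, t, ht, hK⟩ := hc.exists_lipschitzOnWith
  obtain ⟨r, hr, hrt⟩ := Metric.mem_nhds_iff.1 ht
  exact ⟨r, hr, K, K.2, fun a ha b hb => by
    simpa [dist_eq_norm] using hK.dist_le_mul a (hrt ha) b (hrt hb)⟩

/-- The size of `1 / (1 - a)` for `‖a‖ ≤ 1 / 2`. -/
theorem half_norm_le_norm_div_one_sub {a z : ℂ} (ha : ‖a‖ ≤ 1 / 2) :
    1 - a ≠ 0 ∧ ‖z‖ / 2 ≤ ‖z / (1 - a)‖ ∧ ‖z / (1 - a)‖ ≤ 2 * ‖z‖ := by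
  have h1 : 1 / 2 ≤ ‖1 - a‖ := by
    have := norm_sub_norm_le 1 a
    rw [norm_one] at this
    linarith
  have h2 : ‖1 - a‖ ≤ 2 := by
    have := norm_sub_le 1 a
    rw [norm_one] at this
    linarith
  have h0 : 0 < ‖1 - a‖ := by linarith
  refine ⟨norm_pos_iff.1 h0, ?_, ?_⟩
  · rw [norm_div]
    exact div_le_div_of_nonneg_left (norm_nonneg z) h0 h2
  · rw [norm_div, div_le_iff₀ h0]
    nlinarith [norm_nonneg z]

/-- Lower bound, linear in `|ε|`, for the vertical distance on a circle `|z| = δ₀`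
between the plaque `{(z, z g(z))}` through the fixed point and its image under
`Φ_ε(z,w) = (z/(1+εv₁z), w/(1+εv₂w))`. -/
theorem stmt_2 (δ : ℝ) (hδ : 0 < δ) (v₁ v₂ : ℂ) (hv₁ : v₁ ≠ 0) (hv₂ : v₂ ≠ 0)
    (m M m₀ : ℝ) (hm : 0 < m) (hM : 0 < M) (hm₀ : 0 < m₀)
    (g : ℂ → ℂ) (hg : DifferentiableOn ℂ g (ball (0 : ℂ) (2 * δ)))
    (hgm : ∀ z ∈ ball (0 : ℂ) (2 * δ), m ≤ ‖g z‖ ∧ ‖g z‖ ≤ M)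
    (hgt : ∀ z ∈ ball (0 : ℂ) (2 * δ), m₀ ≤ ‖g z - v₁ / v₂‖)
    (f : ℂ → ℂ) (hf : ∀ z, f z = z * g z) :
    ∃ δ₀ : ℝ, 0 < δ₀ ∧ δ₀ ≤ δ ∧ ∃ ε₀ > (0 : ℝ), ∃ c₀ > (0 : ℝ),
      ∀ ε : ℂ, 0 < ‖ε‖ → ‖ε‖ < ε₀ → ∀ z : ℂ, ‖z‖ = δ₀ →
        1 - ε * v₁ * z ≠ 0 ∧
        z / (1 - ε * v₁ * z) ∈ ball (0 : ℂ) (2 * δ) ∧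
        1 + ε * v₂ * f (z / (1 - ε * v₁ * z)) ≠ 0 ∧
        c₀ * ‖ε‖ ≤
          ‖f z - f (z / (1 - ε * v₁ * z)) / (1 + ε * v₂ * f (z / (1 - ε * v₁ * z)))‖ := by
  obtain ⟨r, hr, K, hK, hlip⟩ :=
    hg.exists_ball_norm_sub_le (ball_mem_nhds 0 (by positivity : 0 < 2 * δ))
  have hn₁ : 0 < ‖v₁‖ := norm_pos_iff.2 hv₁
  have hn₂ : 0 < ‖v₂‖ := norm_pos_iff.2 hv₂
  obtain ⟨δ₀, hδ₀, hδ₀'⟩ : ∃ δ₀ : ℝ, 0 < δ₀ ∧ δ₀ ≤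
      min (δ / 2) (min (r / 4) (m * m₀ * ‖v₂‖ / (4 * (K + 1) * ‖v₁‖))) :=
    ⟨_, by positivity, le_rfl⟩
  simp only [le_min_iff] at hδ₀'
  obtain ⟨hδδ, hδr, hδK⟩ := hδ₀'
  rw [le_div_iff₀ (by positivity)] at hδK
  refine ⟨δ₀, hδ₀, by linarith,
    min (1 / (2 * ‖v₁‖ * δ₀)) (1 / (4 * ‖v₂‖ * δ₀ * M)), by positivity,
    δ₀ ^ 2 * (m * m₀ * ‖v₂‖) / 8, by positivity, ?_⟩
  intro ε _ hε z hz
  rw [lt_min_iff, lt_div_iff₀ (by positivity), lt_div_iff₀ (by positivity)] at hε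
  obtain ⟨hε₁, hε₂⟩ := hε
  have ha : ‖ε * v₁ * z‖ ≤ 1 / 2 := by
    rw [norm_mul, norm_mul, hz]
    linarith
  obtain ⟨hne, hlow, hup⟩ := half_norm_le_norm_div_one_sub (z := z) ha
  obtain ⟨w, hw⟩ : ∃ w, w = z / (1 - ε * v₁ * z) := ⟨_, rfl⟩
  rw [← hw, hz] at hlow hup
  rw [← hw]
  have hzw : z - w = -(ε * v₁ * z * w) := by
    have : w * (1 - ε * v₁ * z) = z := by rw [hw, div_mul_cancel₀ _ hne]
    linear_combination -this
  have hwδ : w ∈ ball (0 : ℂ) (2 * δ) := by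
    rw [mem_ball_zero_iff]
    linarith
  have hzδ : z ∈ ball (0 : ℂ) (2 * δ) := by
    rw [mem_ball_zero_iff]
    linarith
  have hfw : ‖ε * v₂ * f w‖ ≤ 1 / 2 := by
    rw [hf, norm_mul, norm_mul, norm_mul]
    calc ‖ε‖ * ‖v₂‖ * (‖w‖ * ‖g w‖) ≤ ‖ε‖ * ‖v₂‖ * (2 * δ₀ * M) := by
          gcongr
          exact (hgm w hwδ).2
      _ ≤ 1 / 2 := by linarith
  have hfw' : ‖-(ε * v₂ * f w)‖ ≤ 1 / 2 := by rwa [norm_neg]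
  obtain ⟨hne', hlow', -⟩ :=
    half_norm_le_norm_div_one_sub (z := f z * (1 + ε * v₂ * f w) - f w) hfw'
  rw [sub_neg_eq_add] at hne' hlow'
  refine ⟨hne, hwδ, hne', ?_⟩
  rw [sub_div, mul_div_cancel_right₀ _ hne'] at hlow'
  refine le_trans ?_ hlow'
  have hnum : f z * (1 + ε * v₂ * f w) - f w =
      ε * z * w * (g z * (v₂ * (g w - v₁ / v₂))) - w * (g w - g z) := by
    have : v₂ * (g w - v₁ / v₂) = v₂ * g w - v₁ := by field_simp
    rw [this, hf, hf]
    linear_combination g z * hzw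
  have hmain : ‖ε‖ * δ₀ * ‖w‖ * (m * (‖v₂‖ * m₀)) ≤
      ‖ε * z * w * (g z * (v₂ * (g w - v₁ / v₂)))‖ := by
    simp only [norm_mul, hz]
    gcongr
    · exact (hgm z hzδ).1
    · exact hgt w hwδ
  have hrem : ‖w * (g w - g z)‖ ≤ ‖ε‖ * δ₀ * ‖w‖ * (m * (‖v₂‖ * m₀) / 2) := by
    have hL : ‖g w - g z‖ ≤ K * (‖ε‖ * ‖v₁‖ * δ₀ * ‖w‖) := by
      have := hlip w (by rw [mem_ball_zero_iff]; linarith) z (by rw [mem_ball_zero_iff]; linarith)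
      rwa [norm_sub_rev w z, hzw, norm_neg, norm_mul, norm_mul, norm_mul, hz] at this
    have hsmall : K * ‖v₁‖ * ‖w‖ ≤ m * (‖v₂‖ * m₀) / 2 := by
      calc K * ‖v₁‖ * ‖w‖ ≤ (K + 1) * ‖v₁‖ * (2 * δ₀) := by
            gcongr
            linarith
        _ ≤ m * (‖v₂‖ * m₀) / 2 := by linarith
    calc ‖w * (g w - g z)‖ ≤ ‖w‖ * (K * (‖ε‖ * ‖v₁‖ * δ₀ * ‖w‖)) := by
          rw [norm_mul]
          gcongr
      _ = ‖ε‖ * δ₀ * ‖w‖ * (K * ‖v₁‖ * ‖w‖) := by ring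
      _ ≤ _ := by gcongr
  have hw_low : ‖ε‖ * δ₀ * (δ₀ / 2) * (m * (‖v₂‖ * m₀) / 2) ≤
      ‖ε‖ * δ₀ * ‖w‖ * (m * (‖v₂‖ * m₀) / 2) := by gcongr
  have htri := norm_sub_norm_le (ε * z * w * (g z * (v₂ * (g w - v₁ / v₂)))) (w * (g w - g z))
  rw [hnum]
  linarith
end

section
/- Let $\delta > 0$, $v_1, v_2 \in \mathbb{C}$, and let $f$ be holomorphic on the open disk $D(0, 2\delta)$. For $\epsilon \in \mathbb{C} \setminus \{0\}$ define, where the denominator is nonzero, $g_\epsilon(z) = \dfrac{1}{\epsilon}\Big( f(z) - \dfrac{f(z - \epsilon v_1)}{1 + \epsilon v_2 f(z - \epsilon v_1)} \Big)$. Then $g_\epsilon$ converges uniformly on $\overline{D}(0,\delta)$ to the function $z \mapsto v_1 f'(z) + v_2 f(z)^2$ as $\epsilon \to 0$; precisely, for every $\eta > 0$ there is $\epsilon_0 > 0$ such that for all $\epsilon$ with $0 < |\epsilon| < \epsilon_0$ and all $z \in \overline{D}(0,\delta)$ one has $z - \epsilon v_1 \in D(0,2\delta)$, $1 + \epsilon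 v_2 f(z - \epsilon v_1) \neq 0$, and $\big| g_\epsilon(z) - \big(v_1 f'(z) + v_2 f(z)^2\big) \big| < \eta$. -/
open Metric Complex

open Filter Topology

/-- Joint limit of difference quotients with moving base point at a point of strict
differentiability. -/
lemma HasStrictDerivAt.tendsto_moving_slope {f : ℂ → ℂ} {f' z₀ : ℂ}
    (hf : HasStrictDerivAt f f' z₀) (v : ℂ) :
    Tendsto (fun p : ℂ × ℂ => (f p.2 - f (p.2 - p.1 * v)) / p.1)
      (𝓝[≠] 0 ×ˢ 𝓝 z₀) (𝓝 (v * f')) := by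
  have hle : 𝓝[≠] (0 : ℂ) ×ˢ 𝓝 z₀ ≤ 𝓝 (0, z₀) := by
    rw [nhds_prod_eq]
    exact prod_mono_left _ nhdsWithin_le_nhds
  have hpair : Tendsto (fun p : ℂ × ℂ => (p.2, p.2 - p.1 * v))
      (𝓝[≠] 0 ×ˢ 𝓝 z₀) (𝓝 (z₀, z₀)) := by
    have hc : Continuous fun p : ℂ × ℂ => (p.2, p.2 - p.1 * v) := by fun_prop
    have := hc.tendsto ((0 : ℂ), z₀)
    simp only [zero_mul, sub_zero] at this
    exact this.mono_left hle
  have ho := hf.hasStrictFDerivAt.isLittleO.comp_tendsto hpair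
  have hO : (fun p : ℂ × ℂ => p.2 - (p.2 - p.1 * v)) =O[𝓝[≠] 0 ×ˢ 𝓝 z₀] fun p => p.1 := by
    simp only [sub_sub_cancel]
    exact Asymptotics.isBigO_of_le' (c := ‖v‖) _ fun p => by rw [norm_mul, mul_comm]
  have hlim := (ho.trans_isBigO hO).tendsto_div_nhds_zero
  have hne : ∀ᶠ p : ℂ × ℂ in 𝓝[≠] 0 ×ˢ 𝓝 z₀, p.1 ≠ 0 :=
    tendsto_fst.eventually self_mem_nhdsWithin
  have hlim' := hlim.add_const (v * f')
  rw [zero_add] at hlim'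
  refine hlim'.congr' ?_
  filter_upwards [hne] with p hp
  simp
  field_simp
  ring

/-- The normalized intersection functions
`g_ε(z) = (1/ε)(f(z) - f(z-εv₁)/(1+εv₂ f(z-εv₁)))` converge uniformly on `closedBall 0 δ`
to `z ↦ v₁ f'(z) + v₂ f(z)²` as `ε → 0`. -/
theorem stmt_3 (δ : ℝ) (hδ : 0 < δ) (v₁ v₂ : ℂ)
    (f : ℂ → ℂ) (hf : DifferentiableOn ℂ f (ball (0 : ℂ) (2 * δ))) :
    ∀ η > (0 : ℝ), ∃ ε₀ > (0 : ℝ), ∀ ε : ℂ, 0 < ‖ε‖ → ‖ε‖ < ε₀ →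
      ∀ z ∈ closedBall (0 : ℂ) δ,
        z - ε * v₁ ∈ ball (0 : ℂ) (2 * δ) ∧
        1 + ε * v₂ * f (z - ε * v₁) ≠ 0 ∧
        ‖(1 / ε) * (f z - f (z - ε * v₁) / (1 + ε * v₂ * f (z - ε * v₁))) -
            (v₁ * deriv f z + v₂ * f z ^ 2)‖ < η := by
  intro η hη
  suffices h : ∀ᶠ ε in 𝓝 (0 : ℂ), ∀ z ∈ closedBall (0 : ℂ) δ, ε ≠ 0 →
      z - ε * v₁ ∈ ball (0 : ℂ) (2 * δ) ∧
        1 + ε * v₂ * f (z - ε * v₁) ≠ 0 ∧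
        ‖(1 / ε) * (f z - f (z - ε * v₁) / (1 + ε * v₂ * f (z - ε * v₁))) -
            (v₁ * deriv f z + v₂ * f z ^ 2)‖ < η by
    obtain ⟨ε₀, hε₀, h⟩ := Metric.eventually_nhds_iff.mp h
    exact ⟨ε₀, hε₀, fun ε hε hlt z hz =>
      h (by rwa [dist_zero_right]) z hz (norm_pos_iff.mp hε)⟩
  refine (isCompact_closedBall (0 : ℂ) δ).eventually_forall_of_forall_eventually fun z₀ hz₀ => ?_
  have hz₀' : z₀ ∈ ball (0 : ℂ) (2 * δ) := closedBall_subset_ball (by linarith) hz₀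
  have han : AnalyticAt ℂ f z₀ := hf.analyticAt (isOpen_ball.mem_nhds hz₀')
  set l : Filter (ℂ × ℂ) := 𝓝[≠] 0 ×ˢ 𝓝 z₀ with hl
  suffices h : ∀ᶠ p : ℂ × ℂ in l,
      p.2 - p.1 * v₁ ∈ ball (0 : ℂ) (2 * δ) ∧
        1 + p.1 * v₂ * f (p.2 - p.1 * v₁) ≠ 0 ∧
        ‖(1 / p.1) * (f p.2 - f (p.2 - p.1 * v₁) / (1 + p.1 * v₂ * f (p.2 - p.1 * v₁))) -
            (v₁ * deriv f p.2 + v₂ * f p.2 ^ 2)‖ < η by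
    have hl' : l = 𝓝 ((0 : ℂ), z₀) ⊓ 𝓟 {p | p.1 ≠ 0} := by
      rw [hl, nhdsWithin, nhds_prod_eq, prod_eq_inf, prod_eq_inf, comap_inf, comap_principal,
        inf_right_comm]
      rfl
    rw [hl', eventually_inf_principal] at h
    exact h
  have hfst : Tendsto (fun p : ℂ × ℂ => p.1) l (𝓝 0) :=
    tendsto_fst.mono_right nhdsWithin_le_nhds
  have hsnd : Tendsto (fun p : ℂ × ℂ => p.2) l (𝓝 z₀) := tendsto_snd
  have hne : ∀ᶠ p : ℂ × ℂ in l, p.1 ≠ 0 := tendsto_fst.eventually self_mem_nhdsWithin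
  have hshift : Tendsto (fun p : ℂ × ℂ => p.2 - p.1 * v₁) l (𝓝 z₀) := by
    simpa using hsnd.sub (hfst.mul_const v₁)
  have hfs : Tendsto (fun p : ℂ × ℂ => f (p.2 - p.1 * v₁)) l (𝓝 (f z₀)) :=
    han.continuousAt.tendsto.comp hshift
  have hfz : Tendsto (fun p : ℂ × ℂ => f p.2) l (𝓝 (f z₀)) :=
    han.continuousAt.tendsto.comp hsnd
  have hdf : Tendsto (fun p : ℂ × ℂ => deriv f p.2) l (𝓝 (deriv f z₀)) :=
    han.deriv.continuousAt.tendsto.comp hsnd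
  have hden : Tendsto (fun p : ℂ × ℂ => 1 + p.1 * v₂ * f (p.2 - p.1 * v₁)) l (𝓝 1) := by
    simpa using ((hfst.mul_const v₂).mul hfs).const_add 1
  have hden_ne := hden.eventually_ne one_ne_zero
  have hquot := (((han.hasStrictDerivAt.tendsto_moving_slope v₁).add
    ((hfz.mul hfs).const_mul v₂)).div hden one_ne_zero).sub
      ((hdf.const_mul v₁).add ((hfz.pow 2).const_mul v₂))
  have hzero : (v₁ * deriv f z₀ + v₂ * (f z₀ * f z₀)) / 1 -
      (v₁ * deriv f z₀ + v₂ * f z₀ ^ 2) = 0 := by ring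
  rw [hzero] at hquot
  have hsmall := hquot.norm.eventually_lt_const (by simpa using hη)
  filter_upwards [hne, hden_ne, hsmall, hshift.eventually_mem (isOpen_ball.mem_nhds hz₀')]
    with p hp hd hs hb
  refine ⟨hb, hd, ?_⟩
  have hquot_eq : (1 / p.1) *
      (f p.2 - f (p.2 - p.1 * v₁) / (1 + p.1 * v₂ * f (p.2 - p.1 * v₁))) =
      ((f p.2 - f (p.2 - p.1 * v₁)) / p.1 + v₂ * (f p.2 * f (p.2 - p.1 * v₁))) /
        (1 + p.1 * v₂ * f (p.2 - p.1 * v₁)) := by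
    generalize f (p.2 - p.1 * v₁) = y at hd ⊢
    rw [eq_div_iff hd, mul_assoc, sub_mul, div_mul_cancel₀ _ hd]
    field_simp
    ring
  rw [hquot_eq]
  exact hs
end

section
/- Let $\delta > 0$ and $v_1, v_2 \in \mathbb{C}$ with $v_1 \neq 0$. Let $f$ be holomorphic on the open disk $D(0, 2\delta)$ with $f(0) = 0$, $f'(0) = 0$, and $f'(z) \neq 0$ for every $z \in D(0,2\delta) \setminus \{0\}$. Then there exists $\epsilon_1 > 0$ such that for every $\epsilon \in \mathbb{C}$ with $0 < |\epsilon| < \epsilon_1$ there exists $z \in D(0,\delta)$ with $z - \epsilon v_1 \in D(0,2\delta)$, $1 + \epsilon v_2 f(z - \epsilon v_1) \neq 0$, and $f(z) = \dfrac{f(z - \epsilon v_1)}{1 + \epsilon v_2 f(z - \epsilon v_1)}$. -/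
open Metric Complex

open Filter Topology Asymptotics

/-- A minimum-modulus criterion for the existence of a zero in a disk. -/
theorem DiffContOnCl.exists_eq_zero_of_norm_center_lt {F : ℂ → ℂ} {c : ℂ} {r C : ℝ} (hr : 0 < r)
    (hF : DiffContOnCl ℂ F (ball c r)) (hC : ∀ z ∈ sphere c r, C ≤ ‖F z‖) (hc : ‖F c‖ < C) :
    ∃ z ∈ closedBall c r, F z = 0 := by
  by_contra! h
  have hC0 : 0 < C := (norm_nonneg _).trans_lt hc
  have hinv : DiffContOnCl ℂ F⁻¹ (ball c r) :=
    hF.inv fun z hz ↦ h z (closure_ball_subset_closedBall hz)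
  have hle : ‖F⁻¹ c‖ ≤ C⁻¹ := by
    refine norm_le_of_forall_mem_frontier_norm_le isBounded_ball hinv (fun z hz ↦ ?_)
      (subset_closure (mem_ball_self hr))
    rw [frontier_ball c hr.ne'] at hz
    rw [Pi.inv_apply, norm_inv]
    exact inv_anti₀ hC0 (hC z hz)
  rw [Pi.inv_apply, norm_inv] at hle
  have hpos : 0 < ‖F c‖ := norm_pos_iff.2 (h c (mem_closedBall_self hr.le))
  exact absurd ((inv_le_inv₀ hpos hC0).1 hle) (not_le.2 hc)

/-- An analytic function vanishing at a point and solving `f' = a f²` near it is zero near it. -/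
theorem AnalyticAt.eventually_eq_zero_of_deriv_eq_mul_sq {f : ℂ → ℂ} {x a : ℂ}
    (hf : AnalyticAt ℂ f x) (hx : f x = 0) (h : ∀ᶠ z in 𝓝 x, deriv f z = a * f z ^ 2) :
    ∀ᶠ z in 𝓝 x, f z = 0 := by
  rw [← analyticOrderAt_eq_top]
  have h₁ : analyticOrderAt (deriv f) x + 1 = analyticOrderAt f x := by
    simpa [hx] using hf.analyticOrderAt_deriv_add_one
  have h₂ : deriv f =ᶠ[𝓝 x] (fun _ ↦ a) * (f * f) := by
    filter_upwards [h] with z hz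
    simp [hz, sq]
  rw [analyticOrderAt_congr h₂, analyticOrderAt_mul analyticAt_const (hf.mul hf),
    analyticOrderAt_mul hf hf] at h₁
  generalize analyticOrderAt f x = o at h₁ ⊢
  generalize analyticOrderAt (fun _ ↦ a) x = k at h₁
  cases o with
  | top => rfl
  | coe n =>
    cases k with
    | top => simp at h₁
    | coe k =>
      norm_cast at h₁
      omega

/-- First order expansion in `ε`, locally uniform in `z`, of the difference between the graph of `f`
and its image under `(z, w) ↦ (z + ε v₁, w / (1 + ε v₂ w))`, with the denominator cleared. -/
theorem HasStrictDerivAt.isLittleO_graph_sub_image {f : ℂ → ℂ} {f' x : ℂ}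
    (hf : HasStrictDerivAt f f' x) (v₁ v₂ : ℂ) :
    (fun p : ℂ × ℂ ↦ f p.2 * (1 + p.1 * v₂ * f (p.2 - p.1 * v₁)) - f (p.2 - p.1 * v₁) -
      p.1 * (v₁ * f' + v₂ * f x ^ 2)) =o[𝓝 ((0 : ℂ), x)] fun p ↦ p.1 := by
  have hshift : Tendsto (fun p : ℂ × ℂ ↦ p.2 - p.1 * v₁) (𝓝 (0, x)) (𝓝 x) := by
    have : Continuous fun p : ℂ × ℂ ↦ p.2 - p.1 * v₁ := by fun_prop
    simpa using this.tendsto (0, x)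
  have hsnd : Tendsto (fun p : ℂ × ℂ ↦ p.2) (𝓝 (0, x)) (𝓝 x) := continuous_snd.tendsto (0, x)
  have hdiff : (fun p : ℂ × ℂ ↦ f p.2 - f (p.2 - p.1 * v₁) - p.1 * v₁ * f')
      =o[𝓝 (0, x)] fun p ↦ p.1 := by
    have h := (hasStrictFDerivAt_iff_isLittleO.1 hf.hasStrictFDerivAt).comp_tendsto
      (hsnd.prodMk_nhds hshift)
    have h' : (fun p : ℂ × ℂ ↦ p.1 * v₁) =O[𝓝 (0, x)] fun p ↦ p.1 := by
      simpa [mul_comm] using isBigO_const_mul_self v₁ (fun p : ℂ × ℂ ↦ p.1) (𝓝 (0, x))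
    refine IsLittleO.trans_isBigO ?_ h'
    simpa [Function.comp_def] using h
  have hcont := hf.hasDerivAt.continuousAt
  have hsq : (fun p : ℂ × ℂ ↦ p.1 * (v₂ * (f p.2 * f (p.2 - p.1 * v₁)) - v₂ * f x ^ 2))
      =o[𝓝 (0, x)] fun p ↦ p.1 := by
    have ht : Tendsto (fun p : ℂ × ℂ ↦ v₂ * (f p.2 * f (p.2 - p.1 * v₁)) - v₂ * f x ^ 2)
        (𝓝 (0, x)) (𝓝 0) := by
      have := (((hcont.tendsto.comp hsnd).mul (hcont.tendsto.comp hshift)).const_mul v₂).sub_const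
        (v₂ * f x ^ 2)
      simpa [sq, Function.comp_def] using this
    simpa using (isBigO_refl (fun p : ℂ × ℂ ↦ p.1) (𝓝 (0, x))).mul_isLittleO
      ((isLittleO_one_iff ℂ).2 ht)
  refine (hdiff.add hsq).congr_left fun p ↦ ?_
  ring

/-- A graph plaque with horizontal tangent at `0` intersects its image under
`Φ_ε(z,w) = (z + εv₁, w/(1+εv₂w))` for all sufficiently small `ε ≠ 0`. -/
theorem stmt_6 (δ : ℝ) (hδ : 0 < δ) (v₁ v₂ : ℂ) (hv₁ : v₁ ≠ 0)
    (f : ℂ → ℂ) (hf : DifferentiableOn ℂ f (ball (0 : ℂ) (2 * δ)))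
    (hf0 : f 0 = 0) (hf'0 : deriv f 0 = 0)
    (hf' : ∀ z ∈ ball (0 : ℂ) (2 * δ), z ≠ 0 → deriv f z ≠ 0) :
    ∃ ε₁ > (0 : ℝ), ∀ ε : ℂ, 0 < ‖ε‖ → ‖ε‖ < ε₁ →
      ∃ z ∈ ball (0 : ℂ) δ,
        z - ε * v₁ ∈ ball (0 : ℂ) (2 * δ) ∧
        1 + ε * v₂ * f (z - ε * v₁) ≠ 0 ∧
        f z = f (z - ε * v₁) / (1 + ε * v₂ * f (z - ε * v₁)) := by
  have han : AnalyticOnNhd ℂ f (ball 0 (2 * δ)) := hf.analyticOnNhd isOpen_ball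
  have h0 : (0 : ℂ) ∈ ball (0 : ℂ) (2 * δ) := mem_ball_self (by positivity)
  set G : ℂ → ℂ := fun z ↦ v₁ * deriv f z + v₂ * f z ^ 2 with hG
  have hGan : AnalyticOnNhd ℂ G (ball 0 (2 * δ)) := fun z hz ↦
    (analyticAt_const.mul (han z hz).deriv).add (analyticAt_const.mul ((han z hz).pow 2))
  have hGne : ∀ᶠ z in 𝓝[≠] (0 : ℂ), G z ≠ 0 := by
    refine (hGan 0 h0).eventually_eq_zero_or_eventually_ne_zero.resolve_left fun h ↦ ?_
    have hfz : f =ᶠ[𝓝 0] fun _ ↦ 0 := by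
      refine (han 0 h0).eventually_eq_zero_of_deriv_eq_mul_sq (a := -v₂ / v₁) hf0 ?_
      filter_upwards [h] with z hz
      rw [hG] at hz
      field_simp
      linear_combination hz
    have hd : ∀ᶠ z in 𝓝[≠] (0 : ℂ), deriv f z = 0 := by
      refine Eventually.filter_mono nhdsWithin_le_nhds ?_
      filter_upwards [hfz.deriv] with z hz
      simpa using hz
    obtain ⟨z, ⟨hz, hzb⟩, hzne⟩ := ((hd.and (nhdsWithin_le_nhds (isOpen_ball.mem_nhds h0))).and
      self_mem_nhdsWithin).exists
    exact hf' z hzb hzne hz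
  obtain ⟨R, hR, hRG⟩ := Metric.eventually_nhds_iff.1 (eventually_nhdsWithin_iff.1 hGne)
  obtain ⟨r, hr, hrR⟩ := exists_between (lt_min hR hδ)
  obtain ⟨hrR, hrδ⟩ := lt_min_iff.1 hrR
  have hsub : closedBall (0 : ℂ) r ⊆ ball 0 (2 * δ) := closedBall_subset_ball (by linarith)
  obtain ⟨z₀, hz₀, hmin⟩ := (isCompact_sphere (0 : ℂ) r).exists_isMinOn
    (NormedSpace.sphere_nonempty.2 hr.le)
    (hGan.continuousOn.mono (sphere_subset_closedBall.trans hsub)).norm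
  have hm : 0 < ‖G z₀‖ := norm_pos_iff.2 (hRG (by rw [mem_sphere.1 hz₀]; exact hrR)
    (ne_of_mem_sphere hz₀ hr.ne'))
  set m := ‖G z₀‖
  set F : ℂ → ℂ → ℂ := fun ε z ↦ f z * (1 + ε * v₂ * f (z - ε * v₁)) - f (z - ε * v₁)
  have hexp : ∀ z ∈ closedBall (0 : ℂ) r, ∀ᶠ p : ℂ × ℂ in 𝓝 (0, z),
      ‖F p.1 p.2 - p.1 * G z‖ ≤ m / 3 * ‖p.1‖ := fun z hz ↦
    ((han z (hsub hz)).hasStrictDerivAt.isLittleO_graph_sub_image v₁ v₂).bound (by positivity)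
  have hsphere : ∀ᶠ ε in 𝓝 (0 : ℂ), ∀ z ∈ sphere (0 : ℂ) r, m / 2 * ‖ε‖ ≤ ‖F ε z‖ := by
    refine (isCompact_sphere 0 r).eventually_forall_of_forall_eventually fun z hz ↦ ?_
    filter_upwards [hexp z (sphere_subset_closedBall hz)] with p hp
    have h₁ : m * ‖p.1‖ ≤ ‖p.1 * G z‖ := by
      rw [norm_mul, mul_comm]
      exact mul_le_mul_of_nonneg_left (hmin hz) (norm_nonneg _)
    have h₂ := norm_sub_norm_le (p.1 * G z) (F p.1 p.2)
    rw [norm_sub_rev (p.1 * G z)] at h₂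
    have h₃ : 0 ≤ m * ‖p.1‖ := by positivity
    linarith
  have hcenter : ∀ᶠ ε in 𝓝 (0 : ℂ), ‖F ε 0‖ ≤ m / 3 * ‖ε‖ := by
    have ht : Tendsto (fun ε : ℂ ↦ (ε, (0 : ℂ))) (𝓝 0) (𝓝 (0, 0)) :=
      (Continuous.prodMk_left (0 : ℂ)).tendsto 0
    filter_upwards [ht.eventually (hexp 0 (mem_closedBall_self hr.le))] with ε hε
    simpa [hG, hf0, hf'0] using hε
  have hshift (z : ℂ) : Tendsto (fun p : ℂ × ℂ ↦ p.2 - p.1 * v₁) (𝓝 (0, z)) (𝓝 z) := by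
    have : Continuous fun p : ℂ × ℂ ↦ p.2 - p.1 * v₁ := by fun_prop
    simpa using this.tendsto (0, z)
  have hdom : ∀ᶠ ε in 𝓝 (0 : ℂ), ∀ z ∈ closedBall (0 : ℂ) r,
      z - ε * v₁ ∈ ball (0 : ℂ) (2 * δ) ∧ 1 + ε * v₂ * f (z - ε * v₁) ≠ 0 := by
    refine (isCompact_closedBall 0 r).eventually_forall_of_forall_eventually fun z hz ↦ ?_
    have hden : Tendsto (fun p : ℂ × ℂ ↦ 1 + p.1 * v₂ * f (p.2 - p.1 * v₁)) (𝓝 (0, z)) (𝓝 1) := by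
      have := (((continuous_fst.tendsto ((0 : ℂ), z)).mul_const v₂).mul
        ((han z (hsub hz)).continuousAt.tendsto.comp (hshift z))).const_add 1
      simpa [Function.comp_def] using this
    exact ((hshift z).eventually (isOpen_ball.mem_nhds (hsub hz))).and
      (hden.eventually_ne one_ne_zero)
  obtain ⟨ε₁, hε₁, H⟩ := Metric.eventually_nhds_iff.1 (hsphere.and (hcenter.and hdom))
  refine ⟨ε₁, hε₁, fun ε hε hεlt ↦ ?_⟩
  obtain ⟨hs, hc, hd⟩ := H (by simpa using hεlt)
  have hFd : DifferentiableOn ℂ (F ε) (closedBall 0 r) := by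
    have h₁ : DifferentiableOn ℂ (fun z ↦ f (z - ε * v₁)) (closedBall 0 r) :=
      hf.comp (by fun_prop) fun z hz ↦ (hd z hz).1
    exact ((hf.mono hsub).mul ((h₁.const_mul (ε * v₂)).const_add 1)).sub h₁
  obtain ⟨z, hz, hzF⟩ := DiffContOnCl.exists_eq_zero_of_norm_center_lt hr
    (hFd.mono closure_ball_subset_closedBall).diffContOnCl hs
    (hc.trans_lt (by have := mul_pos hm hε; linarith))
  refine ⟨z, closedBall_subset_ball hrδ hz, (hd z hz).1, (hd z hz).2, ?_⟩
  rw [eq_div_iff (hd z hz).2]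
  exact sub_eq_zero.1 hzF
end

section
/- Let $\delta > 0$ and $v_1, v_2 \in \mathbb{C}$ with $v_1 \neq 0$. Let $f$ be holomorphic on the open disk $D(0, 2\delta)$ with $f(0) = 0$, $f'(0) = 0$, and $f'(z) \neq 0$ for every $z \in D(0,2\delta) \setminus \{0\}$. Then there exist $\eta > 0$ and $\epsilon_1 > 0$ such that for every function $h$ holomorphic on $D(0,2\delta)$ with $\sup_{z \in D(0,2\delta)} |h(z) - f(z)| < \eta$ and every $\epsilon \in \mathbb{C}$ with $0 < |\epsilon| < \epsilon_1$, there exists $z \in D(0,\delta)$ with $z - \epsilon v_1 \in D(0,2\delta)$, $1 + \epsilon v_2 h(z - \epsilon v_1) \neq 0$, and $h(z)\,\big(1 + \epsilon v_2\, h(z - \epsilon v_1)\big) = h(z - \epsilon v_1)$. -/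
open Metric Complex

/-- A holomorphic function whose modulus at the centre of a disk is smaller than its modulus on the
boundary circle has a zero in the disk. -/
theorem Complex.exists_zero_of_norm_lt_of_le_norm_sphere {G : ℂ → ℂ} {c : ℂ} {r m : ℝ}
    (hr : 0 < r) (hG : DifferentiableOn ℂ G (closedBall c r)) (hc : ‖G c‖ < m)
    (hs : ∀ z ∈ sphere c r, m ≤ ‖G z‖) : ∃ z ∈ ball c r, G z = 0 := by
  have hm : 0 < m := (norm_nonneg _).trans_lt hc
  by_contra! hne
  have hne' : ∀ z ∈ closedBall c r, G z ≠ 0 := by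
    intro z hz
    rcases (mem_closedBall.1 hz).lt_or_eq with h | h
    · exact hne z h
    · exact norm_pos_iff.1 (hm.trans_le (hs z h))
  have hd : DifferentiableOn ℂ (fun z => (G z)⁻¹) (closedBall c r) := hG.fun_inv hne'
  have hmax : ‖(G c)⁻¹‖ ≤ m⁻¹ := by
    refine Complex.norm_le_of_forall_mem_frontier_norm_le isBounded_ball
      (hd.diffContOnCl_ball subset_rfl) (fun z hz => ?_) (subset_closure (mem_ball_self hr))
    rw [frontier_ball c hr.ne'] at hz
    rw [norm_inv]
    exact inv_anti₀ hm (hs z hz)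
  rw [norm_inv] at hmax
  have hGc : 0 < ‖G c‖ := norm_pos_iff.2 (hne c (mem_ball_self hr))
  exact hc.not_ge ((inv_le_inv₀ hGc hm).1 hmax)

open Filter Topology in
/-- If a nonconstant holomorphic germ `f` vanishes at `c` and `a ≠ 0`, then `a f' + b f ^ 2` does
not vanish on a punctured neighbourhood of `c`. -/
theorem AnalyticAt.eventually_mul_deriv_add_mul_sq_ne_zero {f : ℂ → ℂ} {c a b : ℂ}
    (hf : AnalyticAt ℂ f c) (hfc : f c = 0) (hf' : ∀ᶠ z in 𝓝[≠] c, deriv f z ≠ 0) (ha : a ≠ 0) :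
    ∀ᶠ z in 𝓝[≠] c, a * deriv f z + b * f z ^ 2 ≠ 0 := by
  have hg : AnalyticAt ℂ (fun z => a * deriv f z + b * f z ^ 2) c :=
    (analyticAt_const.mul hf.deriv).add (analyticAt_const.mul (hf.pow 2))
  refine hg.eventually_eq_zero_or_eventually_ne_zero.resolve_left fun h0 => ?_
  have hfin : analyticOrderAt (deriv f) c ≠ ⊤ := by
    intro h
    have h1 : ∀ᶠ z in 𝓝[≠] c, deriv f z = 0 :=
      nhdsWithin_le_nhds (analyticOrderAt_eq_top.1 h)
    obtain ⟨z, hz, hz'⟩ := (h1.and hf').exists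
    exact hz' hz
  have hadd : analyticOrderAt (deriv f) c + 1 = analyticOrderAt f c := by
    simpa [hfc] using hf.analyticOrderAt_deriv_add_one
  have hmul : analyticOrderAt (deriv f) c =
      analyticOrderAt (fun _ : ℂ => -b / a) c + 2 • analyticOrderAt f c := by
    rw [← analyticOrderAt_pow hf, ← analyticOrderAt_mul analyticAt_const (hf.pow 2)]
    refine analyticOrderAt_congr (h0.mono fun z hz => ?_)
    simp only [Pi.mul_apply, Pi.pow_apply]
    field_simp
    linear_combination hz
  lift analyticOrderAt (deriv f) c to ℕ using hfin with n
  rw [← hadd] at hmul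
  generalize analyticOrderAt (fun _ : ℂ => -b / a) c = k at hmul
  cases k with
  | top => simp at hmul
  | coe k =>
    rw [two_nsmul] at hmul
    norm_cast at hmul
    omega

/-- Increments of a holomorphic function that is small on a disk are small relative to the step
on a smaller concentric disk. -/
theorem Complex.norm_sub_le_of_forall_mem_ball_norm_le {d : ℂ → ℂ} {c : ℂ} {R s η : ℝ}
    (hs : 0 < s) (hd : DifferentiableOn ℂ d (ball c R)) (hη : ∀ z ∈ ball c R, ‖d z‖ ≤ η)
    {x y : ℂ} (hx : x ∈ ball c (R - s)) (hy : y ∈ ball c (R - s)) :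
    ‖d y - d x‖ ≤ η / s * ‖y - x‖ := by
  have hsub : ∀ z ∈ ball c (R - s), closedBall z s ⊆ ball c R := fun z hz =>
    closedBall_subset_ball' (by rw [mem_ball] at hz; linarith)
  refine (convex_ball c (R - s)).norm_image_sub_le_of_norm_deriv_le (𝕜 := ℂ) (fun z hz => ?_)
    (fun z hz => ?_) hx hy
  · exact hd.differentiableAt (isOpen_ball.mem_nhds (hsub z hz (mem_closedBall_self hs.le)))
  · refine norm_deriv_le_of_forall_mem_sphere_norm_le hs
      ((hd.mono (hsub z hz)).diffContOnCl_ball subset_rfl) fun w hw => ?_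
    exact hη w (hsub z hz (sphere_subset_closedBall hw))

/-- The first-order Taylor expansion of a holomorphic function is uniform on compact disks. -/
theorem Complex.exists_forall_norm_sub_sub_mul_deriv_le {f : ℂ → ℂ} {c : ℂ} {R r τ : ℝ}
    (hrR : r < R) (hf : DifferentiableOn ℂ f (ball c R)) (hτ : 0 < τ) :
    ∃ t₀ > 0, ∀ z ∈ closedBall c r, ∀ w ∈ closedBall c r, ‖w - z‖ < t₀ →
      ‖f z - f w - (z - w) * deriv f z‖ ≤ τ * ‖z - w‖ := by
  have hcont : ContinuousOn (deriv f) (closedBall c r) :=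
    (hf.deriv isOpen_ball).continuousOn.mono (closedBall_subset_ball hrR)
  obtain ⟨t₀, ht₀, h⟩ := Metric.uniformContinuousOn_iff.1
    ((isCompact_closedBall c r).uniformContinuousOn_of_continuous hcont) τ hτ
  refine ⟨t₀, ht₀, fun z hz w hw hwz => ?_⟩
  have hdiff : ∀ x ∈ closedBall c r ∩ ball z t₀,
      HasDerivWithinAt (fun x => f x - x * deriv f z) (deriv f x - 1 * deriv f z)
        (closedBall c r ∩ ball z t₀) x := fun x hx =>
    ((hf.differentiableAt (isOpen_ball.mem_nhds
      (closedBall_subset_ball hrR hx.1))).hasDerivAt.sub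
        ((hasDerivAt_id x).mul_const _)).hasDerivWithinAt
  have := Convex.norm_image_sub_le_of_norm_hasDerivWithin_le (C := τ) hdiff (fun x hx => ?_)
    ((convex_closedBall c r).inter (convex_ball z t₀)) ⟨hw, by rwa [mem_ball, dist_eq_norm]⟩
    ⟨hz, mem_ball_self ht₀⟩
  · rwa [show f z - f w - (z - w) * deriv f z =
      f z - z * deriv f z - (f w - w * deriv f z) by ring]
  · rw [one_mul, ← dist_eq_norm]
    exact (h x hx.1 z hz hx.2).le

/-- All graph plaques uniformly close enough to a plaque tangent to the motion at `0`
intersect their own image under `Φ_ε(z,w) = (z + εv₁, w/(1+εv₂w))` for all small `ε ≠ 0`. -/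
theorem stmt_7 (δ : ℝ) (hδ : 0 < δ) (v₁ v₂ : ℂ) (hv₁ : v₁ ≠ 0)
    (f : ℂ → ℂ) (hf : DifferentiableOn ℂ f (ball (0 : ℂ) (2 * δ)))
    (hf0 : f 0 = 0) (hf'0 : deriv f 0 = 0)
    (hf' : ∀ z ∈ ball (0 : ℂ) (2 * δ), z ≠ 0 → deriv f z ≠ 0) :
    ∃ η > (0 : ℝ), ∃ ε₁ > (0 : ℝ),
      ∀ h : ℂ → ℂ, DifferentiableOn ℂ h (ball (0 : ℂ) (2 * δ)) →
        (∀ z ∈ ball (0 : ℂ) (2 * δ), ‖h z - f z‖ < η) →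
        ∀ ε : ℂ, 0 < ‖ε‖ → ‖ε‖ < ε₁ →
          ∃ z ∈ ball (0 : ℂ) δ,
            z - ε * v₁ ∈ ball (0 : ℂ) (2 * δ) ∧
            1 + ε * v₂ * h (z - ε * v₁) ≠ 0 ∧
            h z * (1 + ε * v₂ * h (z - ε * v₁)) = h (z - ε * v₁) := by
  obtain ⟨ρ, hρ, hρne⟩ : ∃ ρ > 0, ∀ z ∈ ball (0 : ℂ) ρ, z ≠ 0 →
      v₁ * deriv f z + v₂ * f z ^ 2 ≠ 0 := by
    have hU : ball (0 : ℂ) (2 * δ) ∈ nhds 0 := ball_mem_nhds _ (by positivity)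
    have := (hf.analyticAt hU).eventually_mul_deriv_add_mul_sq_ne_zero (a := v₁) (b := v₂) hf0
      (eventually_nhdsWithin_iff.2 (Filter.eventually_of_mem hU hf')) hv₁
    exact Metric.eventually_nhds_iff_ball.1 (eventually_nhdsWithin_iff.1 this)
  set r := min (ρ / 2) (δ / 2)
  have hr : 0 < r := by positivity
  have hrρ : r < ρ := (min_le_left _ _).trans_lt (by linarith)
  have hrδ : r ≤ δ / 2 := min_le_right _ _
  have hsub : closedBall (0 : ℂ) δ ⊆ ball 0 (2 * δ) := closedBall_subset_ball (by linarith)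
  have hfc : ContinuousOn f (closedBall 0 δ) := hf.continuousOn.mono hsub
  have hf'c : ContinuousOn (deriv f) (closedBall 0 δ) :=
    (hf.deriv isOpen_ball).continuousOn.mono hsub
  have hrsub : closedBall (0 : ℂ) r ⊆ closedBall 0 δ := closedBall_subset_closedBall (by linarith)
  obtain ⟨m, hm, hmle⟩ : ∃ m > 0, ∀ z ∈ sphere (0 : ℂ) r,
      m ≤ ‖v₁ * deriv f z + v₂ * f z ^ 2‖ := by
    obtain ⟨z₀, hz₀, hmin⟩ := (isCompact_sphere (0 : ℂ) r).exists_isMinOn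
      (NormedSpace.sphere_nonempty.2 hr.le)
      (f := fun z => ‖v₁ * deriv f z + v₂ * f z ^ 2‖)
      (((continuousOn_const.mul hf'c).add (continuousOn_const.mul (hfc.pow 2))).norm.mono
        (sphere_subset_closedBall.trans hrsub))
    refine ⟨_, norm_pos_iff.2 (hρne z₀ ?_ (ne_of_mem_sphere hz₀ hr.ne')), fun z hz => hmin hz⟩
    exact sphere_subset_closedBall.trans (closedBall_subset_ball hrρ) hz₀
  obtain ⟨B, hB⟩ := (isCompact_closedBall (0 : ℂ) δ).exists_bound_of_continuousOn hfc
  have hB0 : 0 ≤ B := (norm_nonneg _).trans (hB 0 (mem_closedBall_self hδ.le))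
  set C := (2 / δ + 1) * ‖v₁‖ + ‖v₂‖ * (2 * (B + 1) + B) with hC_def
  have hC : 0 ≤ C := by positivity
  set η := min 1 (m / (2 * (C + 1)))
  have hη : 0 < η := by positivity
  have hη1 : η ≤ 1 := min_le_left _ _
  have hηC : η * C < m / 2 := by
    calc η * C < η * (C + 1) := by gcongr; linarith
      _ ≤ m / (2 * (C + 1)) * (C + 1) := by gcongr; exact min_le_right _ _
      _ = m / 2 := by field_simp
  obtain ⟨t₀, ht₀, htaylor⟩ := Complex.exists_forall_norm_sub_sub_mul_deriv_le
    (show δ < 2 * δ by linarith) hf hη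
  obtain ⟨t₁, ht₁, hunif⟩ := Metric.uniformContinuousOn_iff.1
    ((isCompact_closedBall (0 : ℂ) δ).uniformContinuousOn_of_continuous hfc) η hη
  have hv₁' : 0 < ‖v₁‖ := norm_pos_iff.2 hv₁
  refine ⟨η, hη, min (min t₀ (min t₁ (δ / 2)) / ‖v₁‖) (1 / (‖v₂‖ * (B + 1) + 1)), by positivity,
    fun h hh hclose ε hε0 hε => ?_⟩
  obtain ⟨hεv₁, hεv₂⟩ := lt_min_iff.1 hε
  rw [lt_div_iff₀ hv₁', ← norm_mul, lt_min_iff, lt_min_iff] at hεv₁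
  obtain ⟨hεt₀, hεt₁, hεδ⟩ := hεv₁
  rw [lt_div_iff₀ (by positivity)] at hεv₂
  have hshift : ∀ z ∈ closedBall (0 : ℂ) r, z - ε * v₁ ∈ closedBall (0 : ℂ) δ := by
    intro z hz
    rw [mem_closedBall_zero_iff] at hz ⊢
    linarith [norm_sub_le z (ε * v₁)]
  have hhB : ∀ z ∈ closedBall (0 : ℂ) δ, ‖h z‖ ≤ B + 1 := by
    intro z hz
    have h1 := norm_add_le (h z - f z) (f z)
    rw [sub_add_cancel] at h1
    linarith [hB z hz, hclose z (hsub hz)]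
  have hest : ∀ z ∈ closedBall (0 : ℂ) r,
      ‖(h z * (1 + ε * v₂ * h (z - ε * v₁)) - h (z - ε * v₁)) -
        ε * (v₁ * deriv f z + v₂ * f z ^ 2)‖ ≤ ‖ε‖ * (η * C) := by
    intro z hz
    have hzδ := hrsub hz
    have hwδ := hshift z hz
    set w := z - ε * v₁ with hw
    have hzw : z - w = ε * v₁ := by rw [hw]; ring
    have hsmall : ‖(h z - f z) - (h w - f w)‖ ≤ η / (δ / 2) * ‖z - w‖ :=
      Complex.norm_sub_le_of_forall_mem_ball_norm_le (d := fun z => h z - f z) (by positivity)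
        (hh.sub hf) (fun x hx => (hclose x hx).le)
        (closedBall_subset_ball (by linarith) hwδ) (closedBall_subset_ball (by linarith) hzδ)
    have htay := htaylor z hzδ w hwδ (by rwa [norm_sub_rev, hzw])
    have hfw : ‖f w - f z‖ ≤ η := by
      rw [← dist_eq_norm]
      exact (hunif w hwδ z hzδ (by rwa [dist_comm, dist_eq_norm, hzw])).le
    have hprod : ‖h z * h w - f z ^ 2‖ ≤ η * (2 * (B + 1) + B) := by
      have h1 : h z * h w - f z ^ 2 =
          h z * ((h w - f w) + (f w - f z)) + f z * (h z - f z) := by ring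
      rw [h1]
      refine (norm_add_le _ _).trans ?_
      rw [norm_mul, norm_mul]
      have h2 : ‖(h w - f w) + (f w - f z)‖ ≤ 2 * η := by
        linarith [norm_add_le (h w - f w) (f w - f z), hclose w (hsub hwδ)]
      calc _ ≤ (B + 1) * (2 * η) + B * η := by
            gcongr
            · exact hhB z hzδ
            · exact hB z hzδ
            · exact (hclose z (hsub hzδ)).le
        _ = _ := by ring
    rw [hzw] at hsmall htay
    have hsplit : (h z * (1 + ε * v₂ * h w) - h w) - ε * (v₁ * deriv f z + v₂ * f z ^ 2) =
        ((h z - f z) - (h w - f w)) + (f z - f w - ε * v₁ * deriv f z) +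
          ε * (v₂ * (h z * h w - f z ^ 2)) := by ring
    rw [hsplit]
    refine norm_add₃_le.trans ?_
    rw [norm_mul ε v₁] at hsmall htay
    rw [norm_mul ε, norm_mul v₂]
    calc _ ≤ η / (δ / 2) * (‖ε‖ * ‖v₁‖) + η * (‖ε‖ * ‖v₁‖) +
          ‖ε‖ * (‖v₂‖ * (η * (2 * (B + 1) + B))) := by gcongr
      _ = _ := by rw [hC_def]; field_simp
  set G : ℂ → ℂ := fun z => h z * (1 + ε * v₂ * h (z - ε * v₁)) - h (z - ε * v₁)
  have hGd : DifferentiableOn ℂ G (closedBall 0 r) := by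
    have hd : DifferentiableOn ℂ h (closedBall 0 r) := hh.mono (hrsub.trans hsub)
    have hds : DifferentiableOn ℂ (fun z => h (z - ε * v₁)) (closedBall 0 r) :=
      hh.comp (by fun_prop) fun z hz => hsub (hshift z hz)
    exact (hd.mul ((differentiableOn_const _).add ((differentiableOn_const _).mul hds))).sub hds
  have hG0 : ‖G 0‖ < ‖ε‖ * (m / 2) := by
    have := hest 0 (mem_closedBall_self hr.le)
    rw [hf'0, hf0] at this
    simp only [mul_zero, ne_eq, OfNat.ofNat_ne_zero, not_false_eq_true, zero_pow, add_zero,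
      sub_zero] at this
    exact this.trans_lt (by gcongr)
  have hGs : ∀ z ∈ sphere (0 : ℂ) r, ‖ε‖ * (m / 2) ≤ ‖G z‖ := by
    intro z hz
    have h1 := hest z (sphere_subset_closedBall hz)
    have h2 := norm_sub_norm_le (ε * (v₁ * deriv f z + v₂ * f z ^ 2)) (G z)
    rw [norm_sub_rev _ (G z), norm_mul ε] at h2
    have h3 : ‖ε‖ * m ≤ ‖ε‖ * ‖v₁ * deriv f z + v₂ * f z ^ 2‖ := by gcongr; exact hmle z hz
    have h4 : ‖ε‖ * (η * C) ≤ ‖ε‖ * (m / 2) := by gcongr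
    linarith
  obtain ⟨z, hz, hz0⟩ := Complex.exists_zero_of_norm_lt_of_le_norm_sphere hr hGd hG0 hGs
  have hzr := ball_subset_closedBall hz
  refine ⟨z, ball_subset_ball (by linarith) hz, hsub (hshift z hzr), fun h0 => ?_,
    sub_eq_zero.1 hz0⟩
  have h1 : ‖ε * v₂ * h (z - ε * v₁)‖ = 1 := by
    rw [eq_neg_of_add_eq_zero_right h0, norm_neg, norm_one]
  rw [norm_mul, norm_mul] at h1
  have h2 : ‖ε‖ * ‖v₂‖ * ‖h (z - ε * v₁)‖ ≤ ‖ε‖ * ‖v₂‖ * (B + 1) := by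
    gcongr
    exact hhB _ (hshift z hzr)
  linarith
end

section
/- Let $\delta > 0$ and let $f$ be holomorphic on the open disk $D(0, 2\delta)$ with $f'(0) = 0$ and $f'(z) \neq 0$ for every $z \in D(0,2\delta) \setminus \{0\}$. Then there exists $\epsilon_1 > 0$ such that for every $\epsilon \in \mathbb{C}$ with $0 < |\epsilon| < \epsilon_1$ there exists $z \in D(0,\delta)$ with $z - \epsilon \in D(0,2\delta)$ and $f(z) = f(z - \epsilon)$. -/
open Metric Complex

/-- A holomorphic function whose modulus at the centre of a disk is smaller than on the boundary
circle vanishes somewhere in the disk. -/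
theorem DiffContOnCl.exists_eq_zero_of_norm_lt_sphere {g : ℂ → ℂ} {c : ℂ} {r m : ℝ} (hr : 0 < r)
    (hg : DiffContOnCl ℂ g (ball c r)) (hc : ‖g c‖ < m) (hm : ∀ z ∈ sphere c r, m ≤ ‖g z‖) :
    ∃ z ∈ ball c r, g z = 0 := by
  by_contra! h
  have hm0 : 0 < m := (norm_nonneg _).trans_lt hc
  have hne : ∀ z ∈ closure (ball c r), g z ≠ 0 := by
    intro z hz
    rw [closure_ball c hr.ne', ← ball_union_sphere] at hz
    rcases hz with hz | hz
    · exact h z hz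
    · exact norm_pos_iff.1 (hm0.trans_le (hm z hz))
  have hle : ‖g⁻¹ c‖ ≤ m⁻¹ := by
    refine norm_le_of_forall_mem_frontier_norm_le isBounded_ball (hg.inv hne) (fun z hz => ?_)
      (subset_closure (mem_ball_self hr))
    rw [frontier_ball c hr.ne'] at hz
    rw [Pi.inv_apply, norm_inv]
    exact inv_anti₀ hm0 (hm z hz)
  rw [Pi.inv_apply, norm_inv] at hle
  have hpos : 0 < ‖g c‖ := norm_pos_iff.2 (h c (mem_ball_self hr))
  exact hc.not_ge ((inv_le_inv₀ hpos hm0).1 hle)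

/-- The difference quotients of a holomorphic function converge to its derivative uniformly on
smaller closed disks. -/
theorem exists_norm_sub_sub_deriv_mul_le_of_differentiableOn {f : ℂ → ℂ} {c : ℂ} {r R η : ℝ}
    (hf : DifferentiableOn ℂ f (ball c R)) (hr : r < R) (hη : 0 < η) :
    ∃ d > 0, r + d < R ∧ ∀ z ∈ closedBall c r, ∀ ε : ℂ, ‖ε‖ < d →
      ‖f z - f (z - ε) - deriv f z * ε‖ ≤ η * ‖ε‖ := by
  obtain ⟨s, hrs, hsR⟩ := exists_between hr
  have hcont : ContinuousOn (deriv f) (closedBall c s) :=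
    (hf.deriv isOpen_ball).continuousOn.mono (closedBall_subset_ball hsR)
  obtain ⟨d, hd, hunif⟩ := Metric.uniformContinuousOn_iff_le.1
    ((isCompact_closedBall c s).uniformContinuousOn_of_continuous hcont) η hη
  refine ⟨min d (s - r), lt_min hd (sub_pos.2 hrs), ?_, fun z hz ε hε => ?_⟩
  · linarith [min_le_right d (s - r)]
  have hsub : ∀ w ∈ closedBall z ‖ε‖, w ∈ closedBall c s := by
    intro w hw
    rw [mem_closedBall] at hw hz ⊢
    linarith [dist_triangle w z c, min_le_right d (s - r)]
  have hzε : z ∈ closedBall z ‖ε‖ := mem_closedBall_self (norm_nonneg _)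
  have hder : ∀ w ∈ closedBall z ‖ε‖, HasDerivWithinAt (fun w => f w - deriv f z * w)
      (deriv f w - deriv f z) (closedBall z ‖ε‖) w := by
    intro w hw
    have hfw := (hf.differentiableAt (isOpen_ball.mem_nhds
      (closedBall_subset_ball hsR (hsub w hw)))).hasDerivAt
    exact (hfw.fun_sub (hasDerivAt_const_mul (deriv f z))).hasDerivWithinAt
  have hbound : ∀ w ∈ closedBall z ‖ε‖, ‖deriv f w - deriv f z‖ ≤ η := by
    intro w hw
    rw [← dist_eq_norm]
    exact hunif w (hsub w hw) z (hsub z hzε)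
      ((mem_closedBall.1 hw).trans (hε.le.trans (min_le_left _ _)))
  have hmv := (convex_closedBall z ‖ε‖).norm_image_sub_le_of_norm_hasDerivWithin_le hder hbound
    (x := z - ε) (y := z) (by simp) hzε
  simp only [sub_sub_cancel] at hmv
  calc ‖f z - f (z - ε) - deriv f z * ε‖
      = ‖f z - deriv f z * z - (f (z - ε) - deriv f z * (z - ε))‖ := by ring_nf
    _ ≤ η * ‖ε‖ := hmv

/-- A graph tangent to the horizontal translation at `0` intersects its translate
`{(z+ε, f(z))}` for all sufficiently small `ε ≠ 0`. -/
theorem stmt_8 (δ : ℝ) (hδ : 0 < δ)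
    (f : ℂ → ℂ) (hf : DifferentiableOn ℂ f (ball (0 : ℂ) (2 * δ)))
    (hf'0 : deriv f 0 = 0)
    (hf' : ∀ z ∈ ball (0 : ℂ) (2 * δ), z ≠ 0 → deriv f z ≠ 0) :
    ∃ ε₁ > (0 : ℝ), ∀ ε : ℂ, 0 < ‖ε‖ → ‖ε‖ < ε₁ →
      ∃ z ∈ ball (0 : ℂ) δ, z - ε ∈ ball (0 : ℂ) (2 * δ) ∧ f z = f (z - ε) := by
  have hsub : closedBall (0 : ℂ) δ ⊆ ball 0 (2 * δ) := closedBall_subset_ball (by linarith)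
  obtain ⟨z₀, hz₀, hmin⟩ := (isCompact_sphere (0 : ℂ) δ).exists_isMinOn
    (NormedSpace.sphere_nonempty.2 hδ.le)
    ((hf.deriv isOpen_ball).continuousOn.mono (sphere_subset_closedBall.trans hsub)).norm
  have hm : 0 < ‖deriv f z₀‖ := norm_pos_iff.2
    (hf' z₀ (hsub (sphere_subset_closedBall hz₀)) (ne_of_mem_sphere hz₀ hδ.ne'))
  set m := ‖deriv f z₀‖
  obtain ⟨d, hd, hdR, happrox⟩ := exists_norm_sub_sub_deriv_mul_le_of_differentiableOn hf
    (show δ < 2 * δ by linarith) (show 0 < m / 4 by positivity)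
  refine ⟨d, hd, fun ε hε0 hε => ?_⟩
  have hshift : ∀ z ∈ closedBall (0 : ℂ) δ, z - ε ∈ ball (0 : ℂ) (2 * δ) := by
    intro z hz
    rw [mem_closedBall_zero_iff] at hz
    rw [mem_ball_zero_iff]
    linarith [norm_sub_le z ε]
  have hg : DiffContOnCl ℂ (fun z => f z - f (z - ε)) (ball 0 δ) := by
    refine DifferentiableOn.diffContOnCl ?_
    rw [closure_ball _ hδ.ne']
    exact (hf.mono hsub).sub (hf.comp (by fun_prop) hshift)
  have hmε : 0 < m * ‖ε‖ := mul_pos hm hε0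
  obtain ⟨z, hz, hgz⟩ := hg.exists_eq_zero_of_norm_lt_sphere (m := m * ‖ε‖ / 2) hδ (by
    have h := happrox 0 (mem_closedBall_self hδ.le) ε hε
    rw [hf'0, zero_mul, sub_zero] at h
    linarith) (fun z hz => by
    have h := happrox z (sphere_subset_closedBall hz) ε hε
    have hlow : m * ‖ε‖ ≤ ‖deriv f z * ε‖ := by
      rw [norm_mul]
      exact mul_le_mul_of_nonneg_right (hmin hz) hε0.le
    have htri := norm_sub_norm_le (deriv f z * ε) (f z - f (z - ε))
    rw [norm_sub_rev (deriv f z * ε)] at htri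
    linarith)
  exact ⟨z, hz, hshift z (ball_subset_closedBall hz), sub_eq_zero.1 hgz⟩
end

section
/- Let $\delta > 0$ and let $f$ be holomorphic on the open disk $D(0, 2\delta)$ with $f'(0) = 0$ and $f'(z) \neq 0$ for every $z \in D(0,2\delta) \setminus \{0\}$. Then there exist $\eta > 0$ and $\epsilon_1 > 0$ such that for every function $h$ holomorphic on $D(0,2\delta)$ with $\sup_{z \in D(0,2\delta)} |h(z) - f(z)| < \eta$ and every $\epsilon \in \mathbb{C}$ with $0 < |\epsilon| < \epsilon_1$, there exists $z \in D(0,\delta)$ with $z - \epsilon \in D(0,2\delta)$ and $h(z) = h(z - \epsilon)$. -/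
open Metric Complex

/-- Minimum modulus principle: if `|G|` is smaller at the centre of a closed disk than everywhere
on its boundary circle, then `G` vanishes somewhere in the closed disk. -/
theorem exists_zero_of_norm_center_lt {G : ℂ → ℂ} {c : ℂ} {r M : ℝ} (hr : 0 < r)
    (hG : DifferentiableOn ℂ G (closedBall c r)) (hM : ‖G c‖ < M)
    (hs : ∀ z ∈ sphere c r, M ≤ ‖G z‖) : ∃ z ∈ closedBall c r, G z = 0 := by
  by_contra! hne
  have hM0 : 0 < M := (norm_nonneg _).trans_lt hM
  have hinv : DiffContOnCl ℂ (fun z => (G z)⁻¹) (ball c r) := by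
    apply DifferentiableOn.diffContOnCl
    rw [closure_ball c hr.ne']
    exact hG.inv hne
  have hle : ‖(G c)⁻¹‖ ≤ M⁻¹ := by
    refine norm_le_of_forall_mem_frontier_norm_le isBounded_ball hinv (fun z hz => ?_)
      (subset_closure (mem_ball_self hr))
    rw [frontier_ball c hr.ne'] at hz
    rw [norm_inv]
    exact inv_anti₀ hM0 (hs z hz)
  rw [norm_inv] at hle
  have hpos : 0 < ‖G c‖ := norm_pos_iff.2 (hne c (mem_closedBall_self hr.le))
  exact absurd ((inv_le_inv₀ hpos hM0).1 hle) (not_le.2 hM)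

/-- Cauchy estimate: functions that are uniformly close on `D(0, 2δ)` have close derivatives
on `D(0, δ)`. -/
theorem norm_deriv_sub_deriv_le_of_norm_sub_lt {δ η : ℝ} (hδ : 0 < δ) {f h : ℂ → ℂ}
    (hf : DifferentiableOn ℂ f (ball 0 (2 * δ))) (hh : DifferentiableOn ℂ h (ball 0 (2 * δ)))
    (hη : ∀ z ∈ ball (0 : ℂ) (2 * δ), ‖h z - f z‖ < η) {w : ℂ} (hw : w ∈ ball (0 : ℂ) δ) :
    ‖deriv h w - deriv f w‖ ≤ η / δ := by
  have hsub : closedBall w δ ⊆ ball (0 : ℂ) (2 * δ) := by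
    apply closedBall_subset_ball'
    rw [mem_ball] at hw
    linarith
  have hw' : ball (0 : ℂ) (2 * δ) ∈ nhds w :=
    isOpen_ball.mem_nhds (hsub (mem_closedBall_self hδ.le))
  rw [← deriv_fun_sub (hh.differentiableAt hw') (hf.differentiableAt hw')]
  refine norm_deriv_le_of_forall_mem_sphere_norm_le hδ ?_
    (fun z hz => (hη z (hsub (sphere_subset_closedBall hz))).le)
  apply DifferentiableOn.diffContOnCl
  rw [closure_ball w hδ.ne']
  exact (hh.sub hf).mono hsub

/-- Every graph plaque uniformly close enough to a plaque tangent to the horizontal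
translation at `0` intersects its own translate for all small `ε ≠ 0`. -/
theorem stmt_9 (δ : ℝ) (hδ : 0 < δ)
    (f : ℂ → ℂ) (hf : DifferentiableOn ℂ f (ball (0 : ℂ) (2 * δ)))
    (hf'0 : deriv f 0 = 0)
    (hf' : ∀ z ∈ ball (0 : ℂ) (2 * δ), z ≠ 0 → deriv f z ≠ 0) :
    ∃ η > (0 : ℝ), ∃ ε₁ > (0 : ℝ),
      ∀ h : ℂ → ℂ, DifferentiableOn ℂ h (ball (0 : ℂ) (2 * δ)) →
        (∀ z ∈ ball (0 : ℂ) (2 * δ), ‖h z - f z‖ < η) →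
        ∀ ε : ℂ, 0 < ‖ε‖ → ‖ε‖ < ε₁ →
          ∃ z ∈ ball (0 : ℂ) δ, z - ε ∈ ball (0 : ℂ) (2 * δ) ∧ h z = h (z - ε) := by
  have hr : 0 < δ / 2 := half_pos hδ
  have hf'c : ContinuousOn (deriv f) (closedBall 0 δ) :=
    (hf.deriv isOpen_ball).continuousOn.mono (closedBall_subset_ball (by linarith))
  obtain ⟨m, hm, hmf⟩ : ∃ m > 0, ∀ z ∈ sphere (0 : ℂ) (δ / 2), m ≤ ‖deriv f z‖ := by
    have hne : (sphere (0 : ℂ) (δ / 2)).Nonempty := NormedSpace.sphere_nonempty.2 hr.le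
    obtain ⟨z₀, hz₀, hmin⟩ := (isCompact_sphere (0 : ℂ) (δ / 2)).exists_isMinOn hne
      (hf'c.norm.mono (sphere_subset_closedBall.trans (closedBall_subset_closedBall (by linarith))))
    refine ⟨‖deriv f z₀‖, norm_pos_iff.2 (hf' z₀ ?_ (ne_of_mem_sphere hz₀ hr.ne')),
      fun z hz => hmin hz⟩
    rw [mem_ball, mem_sphere.1 hz₀]
    linarith
  obtain ⟨ρ, hρ, huc⟩ := Metric.uniformContinuousOn_iff.1
    ((isCompact_closedBall (0 : ℂ) δ).uniformContinuousOn_of_continuous hf'c) (m / 8) (by linarith)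
  refine ⟨m / 8 * δ, by positivity, min ρ (δ / 2), lt_min hρ hr, fun h hh hη ε hε0 hε => ?_⟩
  have hερ : ‖ε‖ < ρ := hε.trans_le (min_le_left _ _)
  have hεδ : ‖ε‖ < δ / 2 := hε.trans_le (min_le_right _ _)
  have happrox : ∀ z ∈ closedBall (0 : ℂ) (δ / 2),
      ‖h z - h (z - ε) - ε * deriv f z‖ ≤ m / 4 * ‖ε‖ := by
    intro z hz
    rw [mem_closedBall_zero_iff] at hz
    have hnear : ∀ w ∈ closedBall z ‖ε‖, w ∈ ball (0 : ℂ) δ := fun w hw =>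
      closedBall_subset_ball' (by rw [dist_zero_right]; linarith) hw
    have hder : ∀ w ∈ closedBall z ‖ε‖,
        HasDerivWithinAt (fun w => h w - w * deriv f z) (deriv h w - deriv f z)
          (closedBall z ‖ε‖) w := by
      intro w hw
      have hd : DifferentiableAt ℂ h w := hh.differentiableAt
        (isOpen_ball.mem_nhds (ball_subset_ball (by linarith) (hnear w hw)))
      have hl : HasDerivAt (fun w => w * deriv f z) (deriv f z) w := by
        simpa using (hasDerivAt_id w).mul_const (deriv f z)
      exact (hd.hasDerivAt.fun_sub hl).hasDerivWithinAt
    have hbound : ∀ w ∈ closedBall z ‖ε‖, ‖deriv h w - deriv f z‖ ≤ m / 4 := by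
      intro w hw
      have h1 := norm_deriv_sub_deriv_le_of_norm_sub_lt hδ hf hh hη (hnear w hw)
      rw [mul_div_cancel_right₀ _ hδ.ne'] at h1
      have h2 := huc w (ball_subset_closedBall (hnear w hw)) z
        (by rw [mem_closedBall_zero_iff]; linarith) ((mem_closedBall.1 hw).trans_lt hερ)
      rw [dist_eq_norm] at h2
      linarith [norm_sub_le_norm_sub_add_norm_sub (deriv h w) (deriv f w) (deriv f z)]
    have hmv := (convex_closedBall z ‖ε‖).norm_image_sub_le_of_norm_hasDerivWithin_le hder hbound
      (x := z - ε) (y := z) (by simp) (mem_closedBall_self hε0.le)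
    rw [sub_sub_cancel] at hmv
    refine le_of_eq_of_le (congrArg norm ?_) hmv
    ring
  obtain ⟨z, hz, hz0⟩ : ∃ z ∈ closedBall (0 : ℂ) (δ / 2), h z - h (z - ε) = 0 := by
    refine exists_zero_of_norm_center_lt (G := fun z => h z - h (z - ε)) (M := m / 2 * ‖ε‖)
      hr ?_ ?_ ?_
    · refine (hh.mono (closedBall_subset_ball (by linarith))).sub
        (hh.comp (differentiableOn_id.sub_const ε) fun z hz => ?_)
      rw [mem_closedBall_zero_iff] at hz
      rw [mem_ball_zero_iff]
      exact (norm_sub_le z ε).trans_lt (by linarith)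
    · have h0 := happrox 0 (mem_closedBall_self hr.le)
      rw [hf'0, mul_zero, sub_zero] at h0
      exact h0.trans_lt (by gcongr; linarith)
    · intro z hz
      have h1 := happrox z (sphere_subset_closedBall hz)
      have h2 := mul_le_mul_of_nonneg_left (hmf z hz) hε0.le
      rw [← norm_mul] at h2
      have h3 := norm_sub_norm_le (ε * deriv f z) (h z - h (z - ε))
      rw [norm_sub_rev] at h1
      nlinarith [mul_pos hm hε0]
  rw [mem_closedBall_zero_iff] at hz
  refine ⟨z, ?_, ?_, sub_eq_zero.1 hz0⟩ <;> rw [mem_ball_zero_iff]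
  · linarith
  · linarith [norm_sub_le z ε]
end
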